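/- For every integer m ≥ 2 there is a constant C such that the spectral projections S^0_R(Δ_{S^{2m-1}}) are uniformly of weak type (1,1) on H^1: for all λ > 0, R > 0 and f ∈ H^1(S^{2m-1}), σ({x ∈ S^{2m-1} : |S^0_R(Δ_{S^{2m-1}}) f(x)| > λ}) ≤ C ‖f‖_{H^1} / λ. -/

import Mathlib

/-!
STATEMENT 1: For every integer m ≥ 2 the spectral projections S^0_R(Δ_{S^{2m-1}})
are uniformly of weak type (1,1) on H^1: σ({|S^0_R f| > λ}) ≤ C ‖f‖_{H^1}/λ.

Formalization notes: the sphere S^{2m-1} is the unit sphere of ℂ^m = `EuclideanSpace ℂ (Fin m)`.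
The surface measure σ is pinned down (uniquely) by its total mass 2π^m/(m-1)! and invariance
under the unitary group, which acts transitively on the sphere.  The spectral projection
E_{Δ}([0,R)) is pinned down (uniquely) as the continuous linear operator on L²(σ) acting as the
identity on (restrictions to the sphere of) harmonic homogeneous polynomials of degree d — i.e.
smooth harmonic d-homogeneous functions on ℂ^m, viewed as ℝ^{2m} — whose Laplace–Beltrami
eigenvalue d(d+2m-2) is < R, and as 0 on those with eigenvalue ≥ R; these spherical harmonics
span L²(σ).  H^p is the L^p-closure of the class A(∂B_m) of boundary restrictions of functions
holomorphic on the ball and continuous on the closed ball, so uniform boundedness from H^p to L^p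
is expressed on that dense class.
-/

open MeasureTheory Metric Complex
open scoped ENNReal NNReal

noncomputable section

instance (m : ℕ) : MeasurableSpace (EuclideanSpace ℂ (Fin m)) := borel _
instance (m : ℕ) : BorelSpace (EuclideanSpace ℂ (Fin m)) := ⟨rfl⟩

/-- The unit sphere `S^{2m-1}` in `ℂ^m`. -/
abbrev USphere (m : ℕ) := ↥(Metric.sphere (0 : EuclideanSpace ℂ (Fin m)) 1)

/-- The map on the sphere induced by a unitary map of `ℂ^m`. -/
def rotMap (m : ℕ) (U : EuclideanSpace ℂ (Fin m) ≃ₗᵢ[ℂ] EuclideanSpace ℂ (Fin m))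
    (z : USphere m) : USphere m :=
  ⟨U z, by
    have hz := mem_sphere_zero_iff_norm.mp z.2
    exact mem_sphere_zero_iff_norm.mpr (by rw [U.norm_map, hz])⟩

/-- `σ` is the Lebesgue surface measure of `S^{2m-1}`: the unique rotation-invariant Borel
measure with total mass `ω_{2m-1} = 2π^m/(m-1)!` (the unitary group acts transitively). -/
def IsSurfaceMeasure (m : ℕ) (σ : Measure (USphere m)) : Prop :=
  σ Set.univ = ENNReal.ofReal (2 * Real.pi ^ m / (Nat.factorial (m - 1))) ∧
  ∀ U : EuclideanSpace ℂ (Fin m) ≃ₗᵢ[ℂ] EuclideanSpace ℂ (Fin m),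
    Measure.map (rotMap m U) σ = σ

/-- An orthonormal (over ℝ) basis of `ℂ^m` viewed as `ℝ^{2m}`. -/
def rbasis (m : ℕ) (q : Fin m × Bool) : EuclideanSpace ℂ (Fin m) :=
  EuclideanSpace.single q.1 (if q.2 then 1 else Complex.I)

/-- The Euclidean Laplacian of `f : ℂ^m → ℂ` viewed as a function on `ℝ^{2m}`. -/
def lapE (m : ℕ) (f : EuclideanSpace ℂ (Fin m) → ℂ) (x : EuclideanSpace ℂ (Fin m)) : ℂ :=
  ∑ q : Fin m × Bool, iteratedFDeriv ℝ 2 f x ![rbasis m q, rbasis m q]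

/-- (Positively) homogeneous of degree `d` under real dilations. -/
def Homog (m : ℕ) (d : ℕ) (f : EuclideanSpace ℂ (Fin m) → ℂ) : Prop :=
  ∀ (c : ℝ) (x : EuclideanSpace ℂ (Fin m)), f (c • x) = (c ^ d : ℝ) • f x

/-- A (solid) spherical harmonic of degree `d`: a smooth harmonic function on
`ℂ^m ≅ ℝ^{2m}` homogeneous of degree `d`; such functions are exactly the harmonic
homogeneous polynomials of degree `d`. -/
def IsSolidHarmonic (m : ℕ) (d : ℕ) (f : EuclideanSpace ℂ (Fin m) → ℂ) : Prop :=
  ContDiff ℝ (⊤ : ℕ∞) f ∧ Homog m d f ∧ ∀ x, lapE m f x = 0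

/-- The class `A(∂B_m)`: restrictions to the closed ball of functions continuous on the closed
unit ball and holomorphic on the open ball; `H^p` is the `L^p(σ)`-closure of this class. -/
def IsAnalyticBd (m : ℕ) (f : EuclideanSpace ℂ (Fin m) → ℂ) : Prop :=
  ContinuousOn f (Metric.closedBall (0 : EuclideanSpace ℂ (Fin m)) 1) ∧
  DifferentiableOn ℂ f (Metric.ball (0 : EuclideanSpace ℂ (Fin m)) 1)

/-- In finite dimensions, the directional derivatives of a holomorphic function are holomorphic. -/
theorem differentiableOn_fderiv_apply {E : Type*} [NormedAddCommGroup E] [NormedSpace ℂ E]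
    [FiniteDimensional ℂ E] {f : E → ℂ} {U : Set E} (hU : IsOpen U)
    (hf : DifferentiableOn ℂ f U) (v : E) :
    DifferentiableOn ℂ (fun z => fderiv ℂ f z v) U := by
  intro z₀ hz₀
  refine DifferentiableAt.differentiableWithinAt ?_
  have hc : ContinuousAt f z₀ := (hf.differentiableAt (hU.mem_nhds hz₀)).continuousAt
  obtain ⟨δ, hδ, hδU⟩ := Metric.mem_nhds_iff.1
    (Filter.inter_mem (hU.mem_nhds hz₀) (hc.preimage_mem_nhds (ball_mem_nhds (f z₀) one_pos)))
  have hsub : ball z₀ δ ⊆ U := fun x hx => (hδU hx).1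
  have hfδ : ∀ w ∈ ball z₀ δ, f w ∈ ball (f z₀) 1 := fun x hx => (hδU hx).2
  have hbd : ∀ w ∈ ball z₀ (δ / 2), ‖fderiv ℂ f w‖ ≤ 2 / (δ / 2) := by
    intro w hw
    have hwsub : ball w (δ / 2) ⊆ ball z₀ δ := by
      refine ball_subset_ball' ?_
      have := mem_ball.1 hw
      linarith
    refine norm_fderiv_le_div_of_mapsTo_ball (hf.mono (hwsub.trans hsub)) ?_ (by positivity)
    intro x hx
    have h1 := mem_ball.1 (hfδ x (hwsub hx))
    have h2 := mem_ball'.1 (hfδ w (hwsub (mem_ball_self (by positivity))))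
    have := dist_triangle (f x) (f z₀) (f w)
    simp only [mem_closedBall]
    linarith
  set s : ℝ := δ / (4 * (‖v‖ + 1)) with hs
  have hspos : 0 < s := by positivity
  have hsv : s * ‖v‖ ≤ δ / 4 := by
    rw [hs, div_mul_eq_mul_div, div_le_div_iff₀ (by positivity) (by positivity)]
    nlinarith [norm_nonneg v]
  have hmem : ∀ z ∈ ball z₀ (δ / 4), ∀ ζ : ℂ, ‖ζ‖ ≤ s → z + ζ • v ∈ ball z₀ (δ / 2) := by
    intro z hz ζ hζ
    have h1 : ‖ζ • v‖ ≤ δ / 4 := by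
      rw [norm_smul]
      exact (mul_le_mul_of_nonneg_right hζ (norm_nonneg v)).trans hsv
    have h2 := mem_ball.1 hz
    rw [dist_eq_norm] at h2
    rw [mem_ball, dist_eq_norm, add_sub_right_comm]
    linarith [norm_add_le (z - z₀) (ζ • v)]
  have hhalf : ball z₀ (δ / 2) ⊆ U := (ball_subset_ball (by linarith)).trans hsub
  have hdiff : ∀ z ∈ ball z₀ (δ / 2), DifferentiableAt ℂ f z := fun z hz =>
    hf.differentiableAt (hU.mem_nhds (hhalf hz))
  set c : ℝ → ℂ := fun θ => deriv (circleMap 0 s) θ * (1 / (circleMap 0 s θ - 0) ^ 2) with hcdef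
  have hcc : Continuous c := by
    simp only [hcdef, deriv_circleMap, sub_zero]
    have h0 : ∀ θ, circleMap 0 s θ ^ 2 ≠ 0 := fun θ =>
      pow_ne_zero _ (circleMap_ne_center hspos.ne')
    have := continuous_circleMap 0 s
    fun_prop (disch := exact h0)
  have hline : ∀ z ∈ ball z₀ (δ / 4), ∀ ζ : ℂ, ‖ζ‖ ≤ s →
      HasDerivAt (fun ζ : ℂ => f (z + ζ • v)) (fderiv ℂ f (z + ζ • v) v) ζ := by
    intro z hz ζ hζ
    have h1 : HasDerivAt (fun ζ : ℂ => z + ζ • v) v ζ := by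
      simpa using ((hasDerivAt_id ζ).smul_const v).const_add z
    exact (hdiff _ (hmem z hz ζ hζ)).hasFDerivAt.comp_hasDerivAt ζ h1
  have hnorm : ∀ θ, ‖circleMap 0 s θ‖ ≤ s := fun θ => by simp [abs_of_pos hspos]
  have hcauchy : ∀ z ∈ ball z₀ (δ / 4),
      fderiv ℂ f z v = (2 * Real.pi * I)⁻¹ *
        ∫ θ in (0 : ℝ)..2 * Real.pi, c θ * f (z + circleMap 0 s θ • v) := by
    intro z hz
    have hd : DifferentiableOn ℂ (fun ζ : ℂ => f (z + ζ • v)) (closedBall 0 s) := fun ζ hζ =>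
      (hline z hz ζ (by simpa using hζ)).differentiableAt.differentiableWithinAt
    have h1 := hd.deriv_eq_smul_circleIntegral hspos
    have h2 := (hline z hz 0 (by simpa using hspos.le)).deriv
    simp only [zero_smul, add_zero] at h2
    rw [h2, circleIntegral] at h1
    rw [eq_inv_mul_iff_mul_eq₀ two_pi_I_ne_zero, ← smul_eq_mul, ← h1]
    simp only [hcdef, smul_eq_mul, mul_assoc]
  have hball : ball z₀ (δ / 4) ∈ nhds z₀ := ball_mem_nhds _ (by positivity)
  have hcont : ∀ z ∈ ball z₀ (δ / 4),
      Continuous (fun θ : ℝ => c θ * f (z + circleMap 0 s θ • v)) := by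
    intro z hz
    refine hcc.mul (continuous_iff_continuousAt.2 fun θ => ?_)
    have h1 : ContinuousAt (fun θ : ℝ => z + circleMap 0 s θ • v) θ := by
      have := continuous_circleMap 0 s
      fun_prop
    exact ContinuousAt.comp (f := fun θ : ℝ => z + circleMap 0 s θ • v) (g := f)
      (hdiff _ (hmem z hz _ (hnorm θ))).continuousAt h1
  let : MeasurableSpace E := borel E
  have : BorelSpace E := ⟨rfl⟩
  have : ProperSpace E := FiniteDimensional.proper ℂ E
  have : ProperSpace (E →L[ℂ] ℂ) := FiniteDimensional.proper ℂ _
  have hint := intervalIntegral.hasFDerivAt_integral_of_dominated_of_fderiv_le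
    (μ := volume) (a := 0) (b := 2 * Real.pi) (x₀ := z₀) (s := ball z₀ (δ / 4))
    (F := fun z θ => c θ * f (z + circleMap 0 s θ • v))
    (F' := fun z θ => c θ • fderiv ℂ f (z + circleMap 0 s θ • v))
    (bound := fun θ => ‖c θ‖ * (2 / (δ / 2))) hball
    (Filter.eventually_of_mem hball fun z hz => (hcont z hz).aestronglyMeasurable)
    ((hcont z₀ (mem_ball_self (by positivity))).intervalIntegrable _ _)
    (by
      refine AEStronglyMeasurable.smul hcc.aestronglyMeasurable ?_
      have h1 : Measurable fun θ : ℝ => z₀ + circleMap 0 s θ • v := by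
        have := continuous_circleMap 0 s
        exact Continuous.measurable (by fun_prop)
      exact ((measurable_fderiv ℂ f).comp h1).aestronglyMeasurable)
    (Filter.Eventually.of_forall fun θ _ z hz => by
      rw [norm_smul]
      exact mul_le_mul_of_nonneg_left (hbd _ (hmem z hz _ (hnorm θ))) (norm_nonneg _))
    ((hcc.norm.mul continuous_const).intervalIntegrable _ _)
    (Filter.Eventually.of_forall fun θ _ z hz => by
      have h1 : HasFDerivAt (fun z => z + circleMap 0 s θ • v) (ContinuousLinearMap.id ℂ E) z :=
        (hasFDerivAt_id z).add_const _
      have h2 := ((hdiff _ (hmem z hz _ (hnorm θ))).hasFDerivAt.comp z h1).const_mul (c θ)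
      simpa using h2)
  refine (hint.differentiableAt.const_mul ((2 * Real.pi * I)⁻¹)).congr_of_eventuallyEq ?_
  exact Filter.eventually_of_mem hball hcauchy

/-- In finite dimensions, a holomorphic function on an open set is smooth. -/
theorem contDiffOn_of_differentiableOn_complex {E : Type*} [NormedAddCommGroup E]
    [NormedSpace ℂ E] [FiniteDimensional ℂ E] {U : Set E} (hU : IsOpen U) (n : ℕ) :
    ∀ {f : E → ℂ}, DifferentiableOn ℂ f U → ContDiffOn ℂ n f U := by
  induction n with
  | zero => exact fun hf => contDiffOn_zero.2 hf.continuousOn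
  | succ n ih =>
    intro f hf
    push_cast
    refine (contDiffOn_succ_iff_fderiv_of_isOpen hU).2 ⟨hf, by simp, ?_⟩
    exact contDiffOn_clm_apply.2 fun v => ih (differentiableOn_fderiv_apply hU hf v)

/-- A holomorphic function is harmonic for the Euclidean Laplacian. -/
theorem lapE_eq_zero_of_contDiff {m : ℕ} {f : EuclideanSpace ℂ (Fin m) → ℂ}
    (hf : ContDiff ℂ 2 f) (x : EuclideanSpace ℂ (Fin m)) : lapE m f x = 0 := by
  have h : ∀ v : Fin 2 → EuclideanSpace ℂ (Fin m),
      iteratedFDeriv ℝ 2 f x v = iteratedFDeriv ℂ 2 f x v := fun v => by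
    rw [← (hf.contDiffAt (x := x)).restrictScalars_iteratedFDeriv (𝕜 := ℝ) (n := 2)]
    rfl
  rw [lapE, Fintype.sum_prod_type]
  refine Finset.sum_eq_zero fun i _ => ?_
  have hI : rbasis m (i, false) = I • rbasis m (i, true) := by
    ext j
    by_cases hj : j = i <;> simp [rbasis, hj]
  rw [Fintype.sum_bool, h, h, hI]
  have hv : ![I • rbasis m (i, true), I • rbasis m (i, true)] =
      fun j => I • ![rbasis m (i, true), rbasis m (i, true)] j := by
    ext j; fin_cases j <;> rfl
  rw [hv, (iteratedFDeriv ℂ 2 f x).map_smul_univ (fun _ => I)]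
  simp

/-- The component of degree `k` in the homogeneous expansion of `F` at the origin. -/
def homComp {m : ℕ} (F : EuclideanSpace ℂ (Fin m) → ℂ) (k : ℕ)
    (z : EuclideanSpace ℂ (Fin m)) : ℂ :=
  (Nat.factorial k : ℂ)⁻¹ * iteratedFDeriv ℂ k F 0 fun _ => z

theorem homComp_smul {m : ℕ} (F : EuclideanSpace ℂ (Fin m) → ℂ) (k : ℕ) (c : ℂ)
    (z : EuclideanSpace ℂ (Fin m)) : homComp F k (c • z) = c ^ k * homComp F k z := by
  have := (iteratedFDeriv ℂ k F 0).map_smul_univ (fun _ => c) (fun _ => z)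
  simp only [Finset.prod_const, Finset.card_univ, Fintype.card_fin, smul_eq_mul] at this
  rw [homComp, this, homComp]
  ring

theorem contDiff_homComp {m : ℕ} (F : EuclideanSpace ℂ (Fin m) → ℂ) (k : ℕ) {n : WithTop ℕ∞} :
    ContDiff ℂ n (homComp F k) := by
  have h : ContDiff ℂ n fun z : EuclideanSpace ℂ (Fin m) =>
      iteratedFDeriv ℂ k F 0 fun _ => z :=
    (iteratedFDeriv ℂ k F 0).contDiff.comp (contDiff_pi.2 fun _ => contDiff_id)
  exact contDiff_const.mul h

theorem isSolidHarmonic_homComp {m : ℕ} (F : EuclideanSpace ℂ (Fin m) → ℂ) (k : ℕ) :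
    IsSolidHarmonic m k (homComp F k) := by
  refine ⟨(contDiff_homComp F k).restrict_scalars ℝ, fun c x => ?_,
    lapE_eq_zero_of_contDiff (contDiff_homComp F k)⟩
  rw [← Complex.coe_smul, homComp_smul, Complex.real_smul]
  push_cast
  rfl

/-- The Taylor coefficients at the origin of a function of one complex variable. -/
def taylorCoeff (f : ℂ → ℂ) (k : ℕ) : ℂ := (Nat.factorial k : ℂ)⁻¹ * iteratedDeriv k f 0

theorem taylorCoeff_eq_circleIntegral {f : ℂ → ℂ} (hf : DiffContOnCl ℂ f (ball 0 1)) (k : ℕ) :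
    taylorCoeff f k = (2 * Real.pi * I)⁻¹ * ∮ z in C(0, 1), (1 / z ^ (k + 1)) * f z := by
  have h := hf.circleIntegral_one_div_sub_center_pow_smul one_pos k
  simp only [sub_zero, smul_eq_mul] at h
  rw [h, taylorCoeff]
  have := two_pi_I_ne_zero
  field_simp

theorem norm_taylorCoeff_le {f : ℂ → ℂ} (hf : DiffContOnCl ℂ f (ball 0 1)) {M : ℝ}
    (hM : ∀ z ∈ sphere (0 : ℂ) 1, ‖f z‖ ≤ M) (k : ℕ) : ‖taylorCoeff f k‖ ≤ M := by
  rw [taylorCoeff_eq_circleIntegral hf, ← smul_eq_mul]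
  have := circleIntegral.norm_two_pi_i_inv_smul_integral_le_of_norm_le_const zero_le_one
    (f := fun z => (1 / z ^ (k + 1)) * f z) (C := M) (c := 0) fun z hz => by
      rw [norm_mul, norm_div, norm_pow, mem_sphere_zero_iff_norm.1 hz]
      simpa using hM z hz
  simpa using this

theorem hasSum_taylorCoeff {f : ℂ → ℂ} (hf : DiffContOnCl ℂ f (ball 0 1)) {w : ℂ}
    (hw : ‖w‖ < 1) : HasSum (fun k => w ^ k * taylorCoeff f k) (f w) := by
  have hps := hf.hasFPowerSeriesOnBall (R := 1) one_pos
  have hw' : w ∈ Metric.eball (0 : ℂ) (1 : ℝ≥0) := by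
    rw [Metric.eball_coe]
    simpa using hw
  have h := hps.hasSum_iteratedFDeriv hw'
  rw [zero_add] at h
  have he : (fun k => w ^ k * taylorCoeff f k) = fun k =>
      (Nat.factorial k : ℂ)⁻¹ • iteratedFDeriv ℂ k f 0 fun _ => w := by
    ext k
    rw [iteratedFDeriv_apply_eq_iteratedDeriv_mul_prod, taylorCoeff]
    simp only [Finset.prod_const, Finset.card_univ, Fintype.card_fin, smul_eq_mul]
    ring
  rwa [he]

theorem diffContOnCl_slice {m : ℕ} {F : EuclideanSpace ℂ (Fin m) → ℂ} (hF : IsAnalyticBd m F)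
    {z : EuclideanSpace ℂ (Fin m)} (hz : ‖z‖ ≤ 1) :
    DiffContOnCl ℂ (fun ζ : ℂ => F (ζ • z)) (ball 0 1) := by
  have hle : ∀ ζ : ℂ, ‖ζ • z‖ ≤ ‖ζ‖ := fun ζ => by
    rw [norm_smul]; exact mul_le_of_le_one_right (norm_nonneg _) hz
  refine ⟨hF.2.comp (by fun_prop) fun ζ hζ => ?_, ?_⟩
  · rw [mem_ball_zero_iff] at hζ ⊢
    exact (hle ζ).trans_lt hζ
  · rw [closure_ball _ one_ne_zero]
    refine hF.1.comp (by fun_prop) fun ζ hζ => ?_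
    rw [mem_closedBall_zero_iff] at hζ ⊢
    exact (hle ζ).trans hζ

theorem taylorCoeff_slice {m : ℕ} {F : EuclideanSpace ℂ (Fin m) → ℂ} (hF : IsAnalyticBd m F)
    (z : EuclideanSpace ℂ (Fin m)) (k : ℕ) :
    taylorCoeff (fun ζ : ℂ => F (ζ • z)) k = homComp F k z := by
  set g : ℂ →L[ℂ] EuclideanSpace ℂ (Fin m) :=
    (ContinuousLinearMap.id ℂ ℂ).smulRight z
  have h1 := g.iteratedFDerivWithin_comp_right (n := (k : WithTop ℕ∞))
    (contDiffOn_of_differentiableOn_complex isOpen_ball k hF.2) isOpen_ball.uniqueDiffOn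
    (isOpen_ball.preimage g.continuous).uniqueDiffOn (x := 0) (by simp) le_rfl
  rw [iteratedFDerivWithin_of_isOpen k (isOpen_ball.preimage g.continuous) (by simp),
    iteratedFDerivWithin_of_isOpen k isOpen_ball (by simp)] at h1
  have h2 := congrArg (fun L => L fun _ => (1 : ℂ)) h1
  simp only [ContinuousMultilinearMap.compContinuousLinearMap_apply, map_zero] at h2
  rw [taylorCoeff, homComp, iteratedDeriv_eq_iteratedFDeriv]
  congr 1
  simpa [g, Function.comp_def] using h2

theorem eventually_norm_dilate_sub_lt {E : Type*} [NormedAddCommGroup E] [NormedSpace ℝ E]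
    [ProperSpace E] {F : E → ℂ} (hF : ContinuousOn F (closedBall 0 1)) {ε : ℝ} (hε : 0 < ε) :
    ∀ᶠ ρ : ℝ in nhdsWithin 1 (Set.Iio 1), ∀ z ∈ sphere (0 : E) 1, ‖F (ρ • z) - F z‖ < ε := by
  obtain ⟨δ, hδ, h⟩ := Metric.uniformContinuousOn_iff.1
    ((isCompact_closedBall (0 : E) 1).uniformContinuousOn_of_continuous hF) ε hε
  filter_upwards [Ioo_mem_nhdsLT (show max 0 (1 - δ) < 1 by simp [hδ])] with ρ hρ z hz
  have h0 : 0 < ρ := (le_max_left _ _).trans_lt hρ.1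
  have h1 : 1 - δ < ρ := (le_max_right _ _).trans_lt hρ.1
  have hz1 : ‖z‖ = 1 := mem_sphere_zero_iff_norm.1 hz
  rw [← dist_eq_norm]
  refine h _ ?_ _ (sphere_subset_closedBall hz) ?_
  · rw [mem_closedBall_zero_iff, norm_smul, hz1, Real.norm_of_nonneg h0.le, mul_one]
    exact hρ.2.le
  · have h2 : ρ • z - z = (ρ - 1) • z := by rw [sub_smul, one_smul]
    rw [dist_eq_norm, h2, norm_smul, hz1, mul_one, Real.norm_eq_abs, abs_lt]
    constructor <;> linarith [hρ.2]

/-- The Cauchy integral over the unit circle. -/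
def cauchyTransform (h : ℂ → ℂ) (w : ℂ) : ℂ :=
  (2 * Real.pi * I)⁻¹ * ∮ z in C(0, 1), (z - w)⁻¹ * h z

theorem cauchyTransform_eq_circleAverage (h : ℂ → ℂ) (w : ℂ) :
    cauchyTransform h w = Real.circleAverage (fun z => z * ((z - w)⁻¹ * h z)) 0 1 := by
  rw [Real.circleAverage_eq_circleIntegral one_ne_zero, cauchyTransform, smul_eq_mul]
  congr 1
  refine circleIntegral.integral_congr zero_le_one fun z hz => ?_
  have : z ≠ 0 := ne_zero_of_mem_unit_sphere ⟨z, hz⟩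
  simp only [sub_zero, smul_eq_mul]
  field_simp

theorem continuousOn_inv_sub {w : ℂ} (hw : ‖w‖ < 1) :
    ContinuousOn (fun z : ℂ => (z - w)⁻¹) (sphere 0 1) := by
  refine ContinuousOn.inv₀ (by fun_prop) fun z hz h => ?_
  rw [sub_eq_zero.1 h, mem_sphere_zero_iff_norm] at hz
  exact hw.ne hz

theorem circleIntegrable_inv_sub_mul {h : ℂ → ℂ} (hh : ContinuousOn h (sphere 0 1)) {w : ℂ}
    (hw : ‖w‖ < 1) : CircleIntegrable (fun z => (z - w)⁻¹ * h z) 0 1 :=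
  ((continuousOn_inv_sub hw).mul hh).circleIntegrable zero_le_one

theorem cauchyTransform_sub {h₁ h₂ : ℂ → ℂ} (hh₁ : ContinuousOn h₁ (sphere 0 1))
    (hh₂ : ContinuousOn h₂ (sphere 0 1)) {w : ℂ} (hw : ‖w‖ < 1) :
    cauchyTransform (fun z => h₁ z - h₂ z) w = cauchyTransform h₁ w - cauchyTransform h₂ w := by
  simp only [cauchyTransform, mul_sub]
  rw [circleIntegral.integral_sub (circleIntegrable_inv_sub_mul hh₁ hw)
    (circleIntegrable_inv_sub_mul hh₂ hw), mul_sub]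

theorem cauchyTransform_const_mul (c : ℂ) (h : ℂ → ℂ) (w : ℂ) :
    cauchyTransform (fun z => c * h z) w = c * cauchyTransform h w := by
  simp only [cauchyTransform, mul_left_comm _ c, circleIntegral.integral_const_mul]

theorem differentiableOn_cauchyTransform {h : ℂ → ℂ} (hh : ContinuousOn h (sphere 0 1)) :
    DifferentiableOn ℂ (cauchyTransform h) (ball 0 1) := by
  have := (hasFPowerSeriesOn_cauchy_integral (R := 1)
    (hh.circleIntegrable zero_le_one) one_pos).differentiableOn
  rw [Metric.eball_coe] at this
  exact this

theorem re_cauchyTransform_nonneg {u : ℂ → ℝ} (hu : ContinuousOn u (sphere 0 1))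
    (h0 : ∀ z ∈ sphere (0 : ℂ) 1, 0 ≤ u z) {w : ℂ} (hw : ‖w‖ < 1) :
    0 ≤ (cauchyTransform (fun z => (u z : ℂ)) w).re := by
  have hc : ContinuousOn (fun z => (u z : ℂ)) (sphere 0 1) := continuous_ofReal.comp_continuousOn hu
  have hi : CircleIntegrable (fun z => z * ((z - w)⁻¹ * (u z : ℂ))) 0 1 :=
    (continuousOn_id.mul ((continuousOn_inv_sub hw).mul hc)).circleIntegrable zero_le_one
  rw [cauchyTransform_eq_circleAverage, ← reCLM_apply, ← reCLM.circleAverage_comp_comm hi]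
  refine Real.circleAverage_nonneg_of_nonneg fun z hz => ?_
  rw [abs_one] at hz
  have hz1 := mem_sphere_zero_iff_norm.1 hz
  have hne : normSq (z - w) ≠ 0 := by
    rw [Ne, normSq_eq_zero, sub_eq_zero]
    rintro rfl
    exact hw.ne hz1
  have hre : 0 ≤ (z * (z - w)⁻¹).re := by
    have h1 : z * (starRingEnd ℂ) (z - w) = ((‖z‖ ^ 2 : ℝ) : ℂ) - z * (starRingEnd ℂ) w := by
      rw [map_sub, mul_sub, mul_conj, normSq_eq_norm_sq]
    rw [inv_def, ← mul_assoc, re_mul_ofReal, h1, sub_re, ofReal_re, hz1]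
    have h2 := (re_le_norm (z * (starRingEnd ℂ) w))
    rw [norm_mul, RCLike.norm_conj, hz1] at h2
    exact mul_nonneg (by linarith) (inv_nonneg.2 (normSq_nonneg _))
  simp only [Function.comp_apply, reCLM_apply]
  rw [← mul_assoc, re_mul_ofReal]
  exact mul_nonneg hre (h0 z hz)

/-- **Kolmogorov's inequality** for Cauchy integrals of nonnegative densities. -/
theorem weak_type_cauchyTransform_of_nonneg {u : ℂ → ℝ} (hu : ContinuousOn u (sphere 0 1))
    (h0 : ∀ z ∈ sphere (0 : ℂ) 1, 0 ≤ u z) {ρ : ℝ} (hρ0 : 0 < ρ) (hρ : ρ < 1) {lam : ℝ}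
    (hlam : 0 < lam) :
    lam * (volume.restrict (Set.Ioc 0 (2 * Real.pi))).real
        {θ | lam ≤ ‖cauchyTransform (fun z => (u z : ℂ)) (circleMap 0 ρ θ)‖} ≤
      2 * ∫ θ in (0 : ℝ)..2 * Real.pi, u (circleMap 0 1 θ) := by
  set μ := volume.restrict (Set.Ioc 0 (2 * Real.pi)) with hμ
  have hc : ContinuousOn (fun z => (u z : ℂ)) (sphere 0 1) := continuous_ofReal.comp_continuousOn hu
  set K := cauchyTransform (fun z => (u z : ℂ)) with hK
  have hKre : ∀ w : ℂ, ‖w‖ < 1 → 0 ≤ (K w).re := fun w hw => re_cauchyTransform_nonneg hu h0 hw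
  have hKd : DifferentiableOn ℂ K (ball 0 1) := differentiableOn_cauchyTransform hc
  have hne : ∀ w : ℂ, ‖w‖ < 1 → K w + lam ≠ 0 := fun w hw h => by
    have := congrArg re h
    simp only [add_re, ofReal_re, zero_re] at this
    linarith [hKre w hw]
  set G : ℂ → ℂ := fun w => K w / (K w + lam) with hG
  have hGd : DifferentiableOn ℂ G (ball 0 1) :=
    hKd.div (hKd.add_const _) fun w hw => hne w (mem_ball_zero_iff.1 hw)
  have hsub : closedBall (0 : ℂ) |ρ| ⊆ ball 0 1 := by
    rw [abs_of_pos hρ0]; exact closedBall_subset_ball hρ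
  have hGcl : DiffContOnCl ℂ G (ball 0 |ρ|) :=
    (hGd.mono (closure_ball_subset_closedBall.trans hsub)).diffContOnCl
  have hci : CircleIntegrable G 0 ρ :=
    (hGd.continuousOn.mono (sphere_subset_closedBall.trans hsub)).circleIntegrable'
  have hK0 : K 0 = (Real.circleAverage u 0 1 : ℝ) := by
    rw [hK, cauchyTransform_eq_circleAverage]
    rw [Real.circleAverage_congr_sphere (f₂ := fun z => (u z : ℂ))]
    · exact ofRealCLM.circleAverage_comp_comm (hu.circleIntegrable zero_le_one)
    · intro z hz
      rw [abs_one] at hz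
      have : z ≠ 0 := ne_zero_of_mem_unit_sphere ⟨z, hz⟩
      simp only [sub_zero]
      field_simp
  set a := Real.circleAverage u 0 1 with ha
  have ha0 : 0 ≤ a := Real.circleAverage_nonneg_of_nonneg (by simpa using h0)
  have hmean : Real.circleAverage (fun z => (G z).re) 0 ρ = a / (a + lam) := by
    have h1 := reCLM.circleAverage_comp_comm hci
    rw [hGcl.circleAverage] at h1
    have h2 : G 0 = ((a / (a + lam) : ℝ) : ℂ) := by
      simp only [hG, hK0]; push_cast; rfl
    rw [h2, reCLM_apply, ofReal_re] at h1
    exact h1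
  have hGre : ∀ w : ℂ, ‖w‖ < 1 → (G w).re =
      (normSq (K w) + lam * (K w).re) / (normSq (K w) + 2 * lam * (K w).re + lam ^ 2) := by
    intro w hw
    have h1 : normSq (K w + lam) = normSq (K w) + 2 * lam * (K w).re + lam ^ 2 := by
      simp only [normSq_apply, add_re, add_im, ofReal_re, ofReal_im]; ring
    simp only [hG, div_re, h1]
    simp only [normSq_apply, add_re, add_im, ofReal_re, ofReal_im]
    ring
  have hmem : ∀ θ, ‖circleMap 0 ρ θ‖ < 1 := fun θ => by simpa [abs_of_pos hρ0] using hρ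
  have hnn : 0 ≤ᵐ[μ] fun θ => (G (circleMap 0 ρ θ)).re := Filter.Eventually.of_forall fun θ => by
    have := hKre _ (hmem θ)
    have := normSq_nonneg (K (circleMap 0 ρ θ))
    simp only [hGre _ (hmem θ)]
    positivity
  have hint : Integrable (fun θ => (G (circleMap 0 ρ θ)).re) μ :=
    ((intervalIntegrable_iff_integrableOn_Ioc_of_le Real.two_pi_pos.le).1 hci).re
  have hmarkov := mul_meas_ge_le_integral_of_nonneg hnn hint (1 / 2)
  have hset : {θ | lam ≤ ‖K (circleMap 0 ρ θ)‖} ⊆ {θ | 1 / 2 ≤ (G (circleMap 0 ρ θ)).re} := by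
    intro θ hθ
    simp only [Set.mem_ofPred_eq] at hθ ⊢
    have h1 := hKre _ (hmem θ)
    have h2 : lam ^ 2 ≤ normSq (K (circleMap 0 ρ θ)) := by
      rw [normSq_eq_norm_sq]; exact pow_le_pow_left₀ hlam.le hθ 2
    have h3 := normSq_nonneg (K (circleMap 0 ρ θ))
    rw [hGre _ (hmem θ), le_div_iff₀ (by positivity)]
    linarith
  have hle : μ.real {θ | lam ≤ ‖K (circleMap 0 ρ θ)‖} ≤
      μ.real {θ | 1 / 2 ≤ (G (circleMap 0 ρ θ)).re} := measureReal_mono hset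
  have hI : ∫ θ, (G (circleMap 0 ρ θ)).re ∂μ = 2 * Real.pi * (a / (a + lam)) := by
    rw [← hmean, Real.circleAverage_def, smul_eq_mul, mul_inv_cancel_left₀ Real.two_pi_pos.ne',
      intervalIntegral.integral_of_le Real.two_pi_pos.le]
  have hU : ∫ θ in (0 : ℝ)..2 * Real.pi, u (circleMap 0 1 θ) = 2 * Real.pi * a := by
    rw [ha, Real.circleAverage_def, smul_eq_mul, mul_inv_cancel_left₀ Real.two_pi_pos.ne']
  rw [hI] at hmarkov
  rw [hU]
  have hal : lam * (a / (a + lam)) ≤ a := by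
    rw [← mul_div_assoc, div_le_iff₀ (by positivity)]
    nlinarith
  calc lam * μ.real {θ | lam ≤ ‖K (circleMap 0 ρ θ)‖}
      ≤ lam * (2 * (2 * Real.pi * (a / (a + lam)))) := by gcongr; linarith
    _ = 2 * (2 * Real.pi * (lam * (a / (a + lam)))) := by ring
    _ ≤ 2 * (2 * Real.pi * a) := by gcongr

theorem sum_taylorCoeff_eq {f : ℂ → ℂ} (hf : DiffContOnCl ℂ f (ball 0 1)) (N : ℕ) {w : ℂ}
    (hw : ‖w‖ < 1) :
    ∑ k ∈ Finset.range N, w ^ k * taylorCoeff f k =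
      f w - w ^ N * cauchyTransform (fun z => (z ^ N)⁻¹ * f z) w := by
  have hfs : ContinuousOn f (sphere 0 1) :=
    hf.continuousOn_ball.mono sphere_subset_closedBall
  have hne : ∀ z ∈ sphere (0 : ℂ) 1, z ≠ 0 := fun z hz => ne_zero_of_mem_unit_sphere ⟨z, hz⟩
  have hcont : ∀ n : ℕ, ContinuousOn (fun z : ℂ => (z ^ n)⁻¹ * f z) (sphere 0 1) := fun n =>
    ((continuousOn_id.pow n).inv₀ fun z hz => pow_ne_zero _ (hne z hz)).mul hfs
  induction N with
  | zero =>
    have := hf.two_pi_i_inv_smul_circleIntegral_sub_inv_smul (mem_ball_zero_iff.2 hw)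
    simp only [smul_eq_mul] at this
    rw [cauchyTransform]
    simp only [pow_zero, inv_one, one_mul, Finset.range_zero, Finset.sum_empty, this, sub_self]
  | succ N ih =>
    have hstep : taylorCoeff f N = cauchyTransform (fun z => (z ^ N)⁻¹ * f z) w -
        w * cauchyTransform (fun z => (z ^ (N + 1))⁻¹ * f z) w := by
      have hcw : ContinuousOn (fun z => w * ((z ^ (N + 1))⁻¹ * f z)) (sphere 0 1) :=
        continuousOn_const.mul (hcont (N + 1))
      rw [← cauchyTransform_const_mul, ← cauchyTransform_sub (hcont N) hcw hw,
        taylorCoeff_eq_circleIntegral hf,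
        cauchyTransform]
      congr 1
      refine circleIntegral.integral_congr zero_le_one fun z hz => ?_
      have h0 := hne z hz
      have h1 : z - w ≠ 0 := fun h => by
        rw [sub_eq_zero.1 h, mem_sphere_zero_iff_norm] at hz
        exact hw.ne hz
      field_simp
      ring
    rw [Finset.sum_range_succ, ih, hstep]
    ring

/-- Partial sums of the Taylor series of functions in the disc algebra are uniformly of weak
type `(1,1)` on the boundary circle. -/
theorem weak_type_taylor_partialSum {f : ℂ → ℂ} (hf : DiffContOnCl ℂ f (ball 0 1)) (N : ℕ)
    {lam : ℝ} (hlam : 0 < lam) :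
    lam * (volume.restrict (Set.Ioc 0 (2 * Real.pi))).real
        {θ | lam < ‖∑ k ∈ Finset.range N, circleMap 0 1 θ ^ k * taylorCoeff f k‖} ≤
      54 * ∫ θ in (0 : ℝ)..2 * Real.pi, ‖f (circleMap 0 1 θ)‖ := by
  set μ := volume.restrict (Set.Ioc 0 (2 * Real.pi)) with hμ
  set J := ∫ θ in (0 : ℝ)..2 * Real.pi, ‖f (circleMap 0 1 θ)‖ with hJ
  set S : ℂ → ℂ := fun w => ∑ k ∈ Finset.range N, w ^ k * taylorCoeff f k with hS
  have hSc : Continuous S := by fun_prop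
  have hfs : ContinuousOn f (sphere 0 1) :=
    hf.continuousOn_ball.mono sphere_subset_closedBall
  set h : ℂ → ℂ := fun z => (z ^ N)⁻¹ * f z with hh
  have hne : ∀ z ∈ sphere (0 : ℂ) 1, z ≠ 0 := fun z hz => ne_zero_of_mem_unit_sphere ⟨z, hz⟩
  have hhc : ContinuousOn h (sphere 0 1) :=
    ((continuousOn_id.pow N).inv₀ fun z hz => pow_ne_zero _ (hne z hz)).mul hfs
  have hhn : ∀ z ∈ sphere (0 : ℂ) 1, ‖h z‖ = ‖f z‖ := fun z hz => by
    simp [hh, mem_sphere_zero_iff_norm.1 hz]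
  obtain ⟨ρ, ⟨hρS, hρf⟩, hρ0, hρ1⟩ := (((eventually_norm_dilate_sub_lt hSc.continuousOn
      (show 0 < lam / 12 by positivity)).and (eventually_norm_dilate_sub_lt hf.continuousOn_ball
      (show 0 < lam / 12 by positivity))).and
    (Ioo_mem_nhdsLT (show (0 : ℝ) < 1 from one_pos))).exists
  have hsph : ∀ θ, circleMap 0 1 θ ∈ sphere (0 : ℂ) 1 := fun θ =>
    circleMap_mem_sphere 0 zero_le_one θ
  have hdil : ∀ θ, ρ • circleMap 0 1 θ = circleMap 0 ρ θ := fun θ => by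
    simp [circleMap]
  -- the four nonnegative parts of the boundary density
  have part : ∀ L : ℂ → ℝ, Continuous L → (∀ z, |L z| ≤ ‖z‖) →
      lam / 6 * μ.real {θ | lam / 6 ≤
        ‖cauchyTransform (fun z => ((max (L (h z)) 0 : ℝ) : ℂ)) (circleMap 0 ρ θ)‖} ≤ 2 * J := by
    intro L hL hLn
    have hu : ContinuousOn (fun z => max (L (h z)) 0) (sphere 0 1) :=
      (hL.max continuous_const).comp_continuousOn hhc
    refine (weak_type_cauchyTransform_of_nonneg hu (fun z _ => le_max_right _ _) hρ0 hρ1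
      (by positivity)).trans ?_
    refine mul_le_mul_of_nonneg_left ?_ zero_le_two
    refine intervalIntegral.integral_mono_on Real.two_pi_pos.le
      (hu.circleIntegrable zero_le_one) (hfs.norm.circleIntegrable zero_le_one) fun θ _ => ?_
    rw [← hhn _ (hsph θ)]
    exact max_le ((le_abs_self _).trans (hLn _)) (norm_nonneg _)
  have hfint : Integrable (fun θ => ‖f (circleMap 0 1 θ)‖) μ :=
    (intervalIntegrable_iff_integrableOn_Ioc_of_le Real.two_pi_pos.le).1
      (hfs.norm.circleIntegrable zero_le_one)
  have p0 : lam / 6 * μ.real {θ | lam / 6 ≤ ‖f (circleMap 0 1 θ)‖} ≤ J := by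
    rw [hJ, intervalIntegral.integral_of_le Real.two_pi_pos.le]
    exact mul_meas_ge_le_integral_of_nonneg
      (Filter.Eventually.of_forall fun _ => norm_nonneg _) hfint _
  have p1 := part re continuous_re abs_re_le_norm
  have p2 := part (fun z => -re z) continuous_re.neg fun z => by
    rw [abs_neg]; exact abs_re_le_norm z
  have p3 := part im continuous_im abs_im_le_norm
  have p4 := part (fun z => -im z) continuous_im.neg fun z => by
    rw [abs_neg]; exact abs_im_le_norm z
  set A0 := {θ | lam / 6 ≤ ‖f (circleMap 0 1 θ)‖}
  set u1 : ℂ → ℂ := fun z => ((max (re (h z)) 0 : ℝ) : ℂ) with hu1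
  set u2 : ℂ → ℂ := fun z => ((max (-re (h z)) 0 : ℝ) : ℂ) with hu2
  set u3 : ℂ → ℂ := fun z => ((max (im (h z)) 0 : ℝ) : ℂ) with hu3
  set u4 : ℂ → ℂ := fun z => ((max (-im (h z)) 0 : ℝ) : ℂ) with hu4
  set A1 := {θ | lam / 6 ≤ ‖cauchyTransform u1 (circleMap 0 ρ θ)‖}
  set A2 := {θ | lam / 6 ≤ ‖cauchyTransform u2 (circleMap 0 ρ θ)‖}
  set A3 := {θ | lam / 6 ≤ ‖cauchyTransform u3 (circleMap 0 ρ θ)‖}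
  set A4 := {θ | lam / 6 ≤ ‖cauchyTransform u4 (circleMap 0 ρ θ)‖}
  have hpos : ∀ L : ℂ → ℝ, Continuous L →
      ContinuousOn (fun z => ((max (L (h z)) 0 : ℝ) : ℂ)) (sphere 0 1) := fun L hL =>
    continuous_ofReal.comp_continuousOn ((hL.max continuous_const).comp_continuousOn hhc)
  have hc1 : ContinuousOn u1 (sphere 0 1) := hpos re continuous_re
  have hc2 : ContinuousOn u2 (sphere 0 1) := hpos (fun z => -re z) continuous_re.neg
  have hc3 : ContinuousOn u3 (sphere 0 1) := hpos im continuous_im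
  have hc4 : ContinuousOn u4 (sphere 0 1) := hpos (fun z => -im z) continuous_im.neg
  have hdec : h = fun z => (u1 z - u2 z) - (-I) * (u3 z - u4 z) := by
    ext z
    have key : ∀ x : ℝ, max x 0 - max (-x) 0 = x := fun x => by
      rcases le_total 0 x with hx | hx
      · rw [max_eq_left hx, max_eq_right (by linarith)]; ring
      · rw [max_eq_right hx, max_eq_left (by linarith)]; ring
    simp only [hu1, hu2, hu3, hu4]
    rw [← ofReal_sub, ← ofReal_sub, key, key]
    conv_lhs => rw [← re_add_im (h z)]
    ring
  have hK : ∀ w : ℂ, ‖w‖ < 1 → ‖cauchyTransform h w‖ ≤ ‖cauchyTransform u1 w‖ +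
      ‖cauchyTransform u2 w‖ + (‖cauchyTransform u3 w‖ + ‖cauchyTransform u4 w‖) := by
    intro w hw
    have hc12 : ContinuousOn (fun z => u1 z - u2 z) (sphere 0 1) := hc1.sub hc2
    have hc34 : ContinuousOn (fun z => -I * (u3 z - u4 z)) (sphere 0 1) :=
      continuousOn_const.mul (hc3.sub hc4)
    rw [hdec, cauchyTransform_sub hc12 hc34 hw,
      cauchyTransform_const_mul, cauchyTransform_sub hc1 hc2 hw, cauchyTransform_sub hc3 hc4 hw]
    refine (norm_sub_le _ _).trans (add_le_add (norm_sub_le _ _) ?_)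
    rw [norm_mul, norm_neg, norm_I, one_mul]
    exact norm_sub_le _ _
  have hsub : {θ | lam < ‖S (circleMap 0 1 θ)‖} ⊆ A0 ∪ (A1 ∪ (A2 ∪ (A3 ∪ A4))) := by
    intro θ hθ
    by_contra hcon
    simp only [Set.mem_union, A0, A1, A2, A3, A4, Set.mem_ofPred_eq, not_or, not_le] at hcon hθ
    obtain ⟨b0, b1, b2, b3, b4⟩ := hcon
    have e1 := hρS _ (hsph θ)
    have e2 := hρf _ (hsph θ)
    rw [hdil] at e1 e2
    have hw : ‖circleMap 0 ρ θ‖ < 1 := by simpa [abs_of_pos hρ0] using hρ1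
    have e3 : S (circleMap 0 ρ θ) = f (circleMap 0 ρ θ) -
        circleMap 0 ρ θ ^ N * cauchyTransform h (circleMap 0 ρ θ) := sum_taylorCoeff_eq hf N hw
    have e4 : ‖S (circleMap 0 ρ θ)‖ ≤ ‖f (circleMap 0 ρ θ)‖ +
        ‖cauchyTransform h (circleMap 0 ρ θ)‖ := by
      rw [e3]
      refine (norm_sub_le _ _).trans (add_le_add_right ?_ _)
      rw [norm_mul, norm_pow]
      exact mul_le_of_le_one_left (norm_nonneg _) (pow_le_one₀ (norm_nonneg _) hw.le)
    have e5 := hK _ hw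
    have e6 := norm_sub_norm_le (f (circleMap 0 ρ θ)) (f (circleMap 0 1 θ))
    have e7 := norm_sub_norm_le (S (circleMap 0 1 θ)) (S (circleMap 0 ρ θ))
    rw [norm_sub_rev] at e7
    linarith
  have hm : μ.real {θ | lam < ‖S (circleMap 0 1 θ)‖} ≤
      μ.real A0 + (μ.real A1 + (μ.real A2 + (μ.real A3 + μ.real A4))) := by
    refine (measureReal_mono hsub).trans ?_
    refine (measureReal_union_le _ _).trans (add_le_add_right ?_ _)
    refine (measureReal_union_le _ _).trans (add_le_add_right ?_ _)
    refine (measureReal_union_le _ _).trans (add_le_add_right ?_ _)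
    exact measureReal_union_le _ _
  have := mul_le_mul_of_nonneg_left hm hlam.le
  linarith

theorem lintegral_enorm_weak_type_taylor_partialSum {f : ℂ → ℂ}
    (hf : DiffContOnCl ℂ f (ball 0 1)) (N : ℕ) {lam : ℝ} (hlam : 0 < lam) :
    volume.restrict (Set.Ioc 0 (2 * Real.pi))
        {θ | lam < ‖∑ k ∈ Finset.range N, circleMap 0 1 θ ^ k * taylorCoeff f k‖} ≤
      ENNReal.ofReal 54 / ENNReal.ofReal lam *
        ∫⁻ θ in Set.Ioc 0 (2 * Real.pi), ‖f (circleMap 0 1 θ)‖ₑ := by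
  have h := ENNReal.ofReal_le_ofReal (weak_type_taylor_partialSum hf N hlam)
  have hfs : ContinuousOn f (sphere 0 1) :=
    hf.continuousOn_ball.mono sphere_subset_closedBall
  have hfint : IntegrableOn (fun θ => f (circleMap 0 1 θ)) (Set.Ioc 0 (2 * Real.pi)) :=
    (intervalIntegrable_iff_integrableOn_Ioc_of_le Real.two_pi_pos.le).1
      (hfs.circleIntegrable zero_le_one)
  rw [intervalIntegral.integral_of_le Real.two_pi_pos.le, ENNReal.ofReal_mul hlam.le,
    ENNReal.ofReal_mul (by norm_num), ofReal_integral_norm_eq_lintegral_enorm hfint,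
    ofReal_measureReal] at h
  rwa [← ENNReal.mul_div_right_comm, ENNReal.le_div_iff_mul_le (Or.inl (by simpa using hlam))
    (Or.inl ENNReal.ofReal_ne_top), mul_comm]

/-- Multiplication by `e^{iθ}` as a unitary map. -/
def phaseRot (m : ℕ) (θ : ℝ) : EuclideanSpace ℂ (Fin m) ≃ₗᵢ[ℂ] EuclideanSpace ℂ (Fin m) :=
  { LinearEquiv.smulOfNeZero ℂ (EuclideanSpace ℂ (Fin m)) (circleMap 0 1 θ)
      (circleMap_ne_center one_ne_zero) with
    norm_map' := fun z => by
      change ‖circleMap 0 1 θ • z‖ = ‖z‖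
      simp [norm_smul] }

theorem continuous_rotMap_phaseRot (m : ℕ) :
    Continuous fun p : USphere m × ℝ => rotMap m (phaseRot m p.2) p.1 := by
  refine Continuous.subtype_mk (f := fun p : USphere m × ℝ => circleMap 0 1 p.2 • p.1.1) ?_ _
  exact ((continuous_circleMap 0 1).comp continuous_snd).smul
    (continuous_subtype_val.comp continuous_fst)

theorem lintegral_lintegral_rotMap_phaseRot {m : ℕ} {σ : Measure (USphere m)} [SFinite σ]
    (hσ : IsSurfaceMeasure m σ) {φ : USphere m → ℝ≥0∞} (hφ : Measurable φ) :
    ∫⁻ z, (∫⁻ θ in Set.Ioc 0 (2 * Real.pi), φ (rotMap m (phaseRot m θ) z)) ∂σ =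
      ENNReal.ofReal (2 * Real.pi) * ∫⁻ z, φ z ∂σ := by
  have hc := continuous_rotMap_phaseRot m
  rw [lintegral_lintegral_swap (f := fun z θ => φ (rotMap m (phaseRot m θ) z))
    (hφ.comp hc.measurable).aemeasurable]
  have h : ∀ θ, ∫⁻ z, φ (rotMap m (phaseRot m θ) z) ∂σ = ∫⁻ z, φ z ∂σ := fun θ => by
    have hm : Measurable (rotMap m (phaseRot m θ)) :=
      (hc.comp (Continuous.prodMk continuous_id continuous_const)).measurable
    rw [← lintegral_map hφ hm, hσ.2]
  simp only [h, lintegral_const, Measure.restrict_apply MeasurableSet.univ, Set.univ_inter,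
    Real.volume_Ioc, sub_zero]
  exact mul_comm _ _

/-- Sections of the homogeneous expansion of a function in `A(∂B_m)` are uniformly of weak
type `(1,1)`: integrate the one-dimensional estimate over the circles `θ ↦ e^{iθ} z`. -/
theorem measure_homComp_partialSum_le {m : ℕ} {σ : Measure (USphere m)} [SFinite σ]
    (hσ : IsSurfaceMeasure m σ) {F : EuclideanSpace ℂ (Fin m) → ℂ} (hF : IsAnalyticBd m F)
    (N : ℕ) {lam : ℝ} (hlam : 0 < lam) :
    σ {x : USphere m | lam < ‖∑ k ∈ Finset.range N, homComp F k x‖} ≤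
      ENNReal.ofReal 54 * eLpNorm (fun x : USphere m => F ↑x) 1 σ / ENNReal.ofReal lam := by
  set A := {x : USphere m | lam < ‖∑ k ∈ Finset.range N, homComp F k x‖}
  have hSc : Continuous fun x : USphere m => ∑ k ∈ Finset.range N, homComp F k x :=
    continuous_finsetSum _ fun k _ =>
      (contDiff_homComp F k (n := 0)).continuous.comp continuous_subtype_val
  have hAm : MeasurableSet A := (isOpen_lt continuous_const hSc.norm).measurableSet
  have hFc : Continuous fun x : USphere m => F x :=
    hF.1.comp_continuous continuous_subtype_val fun x => sphere_subset_closedBall x.2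
  have h1 := lintegral_lintegral_rotMap_phaseRot hσ
    (φ := A.indicator fun _ => 1) (measurable_const.indicator hAm)
  have h2 := lintegral_lintegral_rotMap_phaseRot hσ hFc.enorm.measurable
  rw [lintegral_indicator_const hAm, one_mul] at h1
  have hpt : ∀ z : USphere m, (∫⁻ θ in Set.Ioc 0 (2 * Real.pi),
      A.indicator (fun _ => (1 : ℝ≥0∞)) (rotMap m (phaseRot m θ) z)) ≤
      ENNReal.ofReal 54 / ENNReal.ofReal lam *
        ∫⁻ θ in Set.Ioc 0 (2 * Real.pi), ‖F (rotMap m (phaseRot m θ) z)‖ₑ := by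
    intro z
    have hrot : Measurable fun θ => rotMap m (phaseRot m θ) z :=
      ((continuous_rotMap_phaseRot m).comp
        (Continuous.prodMk continuous_const continuous_id)).measurable
    have h3 := lintegral_enorm_weak_type_taylor_partialSum
      (diffContOnCl_slice hF (mem_sphere_zero_iff_norm.1 z.2).le) N hlam
    simp only [taylorCoeff_slice hF, ← homComp_smul] at h3
    refine le_trans (le_of_eq ?_) h3
    have h4 : ∀ θ, A.indicator (fun _ => (1 : ℝ≥0∞)) (rotMap m (phaseRot m θ) z) =
        ((fun θ => rotMap m (phaseRot m θ) z) ⁻¹' A).indicator (fun _ => 1) θ := fun θ => rfl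
    simp only [h4]
    rw [lintegral_indicator_const (hrot hAm), one_mul]
    rfl
  have h5 := lintegral_mono hpt (μ := σ)
  rw [h1, lintegral_const_mul' _ _ (ENNReal.div_ne_top ENNReal.ofReal_ne_top
    (by simpa using hlam)), h2, mul_left_comm] at h5
  rw [ENNReal.mul_le_mul_iff_right (by simpa using Real.pi_pos) ENNReal.ofReal_ne_top] at h5
  rw [eLpNorm_one_eq_lintegral_enorm, ENNReal.mul_div_right_comm]
  exact h5

theorem exists_eigenvalue_lt_iff_lt (m : ℕ) (hm : 2 ≤ m) (R : ℝ) :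
    ∃ N : ℕ, ∀ d : ℕ, ((d * (d + 2 * m - 2) : ℕ) : ℝ) < R ↔ d < N := by
  have hex : ∃ d : ℕ, R ≤ ((d * (d + 2 * m - 2) : ℕ) : ℝ) := by
    obtain ⟨n, hn⟩ := exists_nat_ge R
    refine ⟨n, hn.trans (Nat.cast_le.2 (Nat.le_mul_of_pos_right n (by omega)))⟩
  classical
  refine ⟨Nat.find hex, fun d => ⟨fun h => ?_, fun h => not_le.1 (Nat.find_min hex h)⟩⟩
  by_contra! hd
  refine absurd h (not_lt.2 ((Nat.find_spec hex).trans (Nat.cast_le.2 ?_)))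
  exact Nat.mul_le_mul hd (by omega)

/-- The restriction to the sphere of a homogeneous component. -/
def homCompSphere {m : ℕ} (F : EuclideanSpace ℂ (Fin m) → ℂ) (k : ℕ) : C(USphere m, ℂ) :=
  ⟨fun x => homComp F k x, (contDiff_homComp F k (n := 0)).continuous.comp continuous_subtype_val⟩

/-- A continuous linear map killing all homogeneous components of degree at least `N` acts on
functions in `A(∂B_m)` through the first `N` components. -/
theorem apply_eq_sum_homCompSphere {m : ℕ} {W : Type*} [NormedAddCommGroup W] [NormedSpace ℂ W]
    (L : C(USphere m, ℂ) →L[ℂ] W) {F : EuclideanSpace ℂ (Fin m) → ℂ} (hF : IsAnalyticBd m F)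
    {N : ℕ} (hL : ∀ k, N ≤ k → L (homCompSphere F k) = 0) {G : C(USphere m, ℂ)}
    (hG : ∀ x, G x = F x) :
    L G = ∑ k ∈ Finset.range N, L (homCompSphere F k) := by
  obtain ⟨M, hM⟩ :=
    (isCompact_closedBall (0 : EuclideanSpace ℂ (Fin m)) 1).exists_bound_of_continuousOn hF.1
  have hM0 : 0 ≤ M := (norm_nonneg _).trans (hM 0 (by simp))
  have hslice : ∀ x : USphere m, DiffContOnCl ℂ (fun ζ : ℂ => F (ζ • x.1)) (ball 0 1) := fun x =>
    diffContOnCl_slice hF (mem_sphere_zero_iff_norm.1 x.2).le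
  have hbound : ∀ k, ‖homCompSphere F k‖ ≤ M := fun k => by
    refine (ContinuousMap.norm_le _ hM0).2 fun x => ?_
    change ‖homComp F k x‖ ≤ M
    rw [← taylorCoeff_slice hF]
    refine norm_taylorCoeff_le (hslice x) (fun z hz => hM _ ?_) k
    rw [mem_closedBall_zero_iff, norm_smul, mem_sphere_zero_iff_norm.1 hz,
      mem_sphere_zero_iff_norm.1 x.2, one_mul]
  have key : ∀ ρ : ℝ, 0 < ρ → ρ < 1 → ∃ H : C(USphere m, ℂ),
      (∀ x : USphere m, H x = F (ρ • x.1)) ∧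
        L H = ∑ k ∈ Finset.range N, (ρ : ℂ) ^ k • L (homCompSphere F k) := by
    intro ρ h0 h1
    have hρ : ‖(ρ : ℂ)‖ < 1 := by rwa [norm_real, Real.norm_of_nonneg h0.le]
    have hsum : Summable fun k => (ρ : ℂ) ^ k • homCompSphere F k := by
      refine Summable.of_norm_bounded
        ((summable_geometric_of_lt_one (norm_nonneg _) hρ).mul_right M) fun k => ?_
      rw [norm_smul, norm_pow]
      exact mul_le_mul_of_nonneg_left (hbound k) (by positivity)
    refine ⟨∑' k, (ρ : ℂ) ^ k • homCompSphere F k, fun x => ?_, ?_⟩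
    · have e1 := (ContinuousMap.evalCLM ℂ x).hasSum hsum.hasSum
      have e2 := hasSum_taylorCoeff (hslice x) hρ
      simp only [taylorCoeff_slice hF, Complex.coe_smul] at e2
      exact e1.unique e2
    · rw [L.map_tsum hsum, tsum_eq_sum (s := Finset.range N)]
      · simp only [map_smul]
      · intro k hk
        rw [map_smul, hL k (by simpa using hk), smul_zero]
  choose! H hHF hHL using key
  have hmem : Set.Ioo (0 : ℝ) 1 ∈ nhdsWithin 1 (Set.Iio 1) := Ioo_mem_nhdsLT one_pos
  have t1 : Filter.Tendsto H (nhdsWithin 1 (Set.Iio 1)) (nhds G) := by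
    rw [Metric.tendsto_nhds]
    intro ε hε
    filter_upwards [hmem, eventually_norm_dilate_sub_lt hF.1 hε] with ρ hρ h
    rw [ContinuousMap.dist_lt_iff hε]
    intro x
    rw [hHF ρ hρ.1 hρ.2, hG, dist_eq_norm]
    exact h x x.2
  have t2 : Filter.Tendsto (fun ρ : ℝ => ∑ k ∈ Finset.range N, (ρ : ℂ) ^ k • L (homCompSphere F k))
      (nhdsWithin 1 (Set.Iio 1)) (nhds (∑ k ∈ Finset.range N, L (homCompSphere F k))) := by
    have hc : Continuous fun ρ : ℝ =>
        ∑ k ∈ Finset.range N, (ρ : ℂ) ^ k • L (homCompSphere F k) := by fun_prop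
    have := hc.tendsto 1
    simp only [ofReal_one, one_pow, one_smul] at this
    exact this.mono_left nhdsWithin_le_nhds
  refine tendsto_nhds_unique ((L.continuous.tendsto G).comp t1) (t2.congr' ?_)
  filter_upwards [hmem] with ρ hρ
  exact (hHL ρ hρ.1 hρ.2).symm

/-- `T R` plays the role of `S^0_R(Δ_{S^{2m-1}}) = E_{Δ}([0,R))`, pinned down by
its action on spherical harmonics (eigenvalue `d(d+2m-2)`).  The conclusion is the uniform
weak-(1,1) bound on `H^1`, stated on the dense subclass `A(∂B_m)` of `H^1` (for `f ∈ A(∂B_m)`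
one has `‖f‖_{H^1} = ‖f‖_{L^1(σ)}`). -/
theorem bochner_riesz_S0_H1_weak11 (m : ℕ) (hm : 2 ≤ m)
    (σ : Measure (USphere m)) (hσ : IsSurfaceMeasure m σ)
    (T : ℝ → (Lp ℂ 2 σ →L[ℂ] Lp ℂ 2 σ))
    (hT : ∀ (R : ℝ) (d : ℕ) (F : EuclideanSpace ℂ (Fin m) → ℂ), IsSolidHarmonic m d F →
      ∀ g : Lp ℂ 2 σ, (∀ᵐ x ∂σ, g x = F ↑x) →
        T R g = if ((d * (d + 2 * m - 2) : ℕ) : ℝ) < R then g else 0) :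
    ∃ C : ℝ, ∀ R > (0 : ℝ), ∀ lam > (0 : ℝ),
      ∀ F : EuclideanSpace ℂ (Fin m) → ℂ, IsAnalyticBd m F →
      ∀ g : Lp ℂ 2 σ, (∀ᵐ x ∂σ, g x = F ↑x) →
        σ {x : USphere m | lam < ‖(T R g) x‖} ≤
          ENNReal.ofReal C * eLpNorm (fun x : USphere m => F ↑x) 1 σ / ENNReal.ofReal lam := by
  have : IsFiniteMeasure σ := ⟨by rw [hσ.1]; exact ENNReal.ofReal_lt_top⟩
  refine ⟨54, fun R _ lam hlam F hF g hg => ?_⟩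
  obtain ⟨N, hN⟩ := exists_eigenvalue_lt_iff_lt m hm R
  set ι := ContinuousMap.toLp (E := ℂ) 2 σ ℂ
  set G : C(USphere m, ℂ) := ⟨fun x => F x, hF.1.comp_continuous continuous_subtype_val
    fun x => sphere_subset_closedBall x.2⟩
  have hgG : g = ι G := by
    refine Lp.ext ?_
    filter_upwards [hg, ContinuousMap.coeFn_toLp (p := 2) (𝕜 := ℂ) σ G] with x h1 h2
    rw [h1, h2]
    rfl
  have hcomp : ∀ k, T R (ι (homCompSphere F k)) = if k < N then ι (homCompSphere F k) else 0 := by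
    intro k
    rw [hT R k _ (isSolidHarmonic_homComp F k) (ι (homCompSphere F k))
      (ContinuousMap.coeFn_toLp (p := 2) (𝕜 := ℂ) σ (homCompSphere F k))]
    simp only [hN]
  have hTg : T R g = ι (∑ k ∈ Finset.range N, homCompSphere F k) := by
    rw [hgG, map_sum]
    refine (apply_eq_sum_homCompSphere ((T R).comp ι) hF (N := N) (fun k hk => ?_)
      fun x => rfl).trans (Finset.sum_congr rfl fun k hk => ?_)
    · rw [ContinuousLinearMap.comp_apply, hcomp, if_neg (not_lt.2 hk)]
    · rw [ContinuousLinearMap.comp_apply, hcomp, if_pos (Finset.mem_range.1 hk)]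
  have hae : ∀ᵐ x ∂σ, T R g x = ∑ k ∈ Finset.range N, homComp F k x := by
    rw [hTg]
    filter_upwards [ContinuousMap.coeFn_toLp (p := 2) (𝕜 := ℂ) σ
      (∑ k ∈ Finset.range N, homCompSphere F k)] with x hx
    rw [hx, ContinuousMap.sum_apply]
    rfl
  refine (measure_mono_ae ?_).trans (measure_homComp_partialSum_le hσ hF N hlam)
  filter_upwards [hae] with x hx h
  change lam < ‖∑ k ∈ Finset.range N, homComp F k x‖
  rw [← hx]
  exact h
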